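/- arXiv:2310.06195 — 9 statements merged into one kernel-verified Lean document; each statement's English description precedes it below -/
import Mathlib

section
/- Assume the penalty conditions (P), the noise bound H(f^δ, f) ≤ δ², and that the multiplicative MHDM iterates u_k with partial products x_k are well-defined. Then for every k ≥ 0 the residual satisfies H(f^δ, T x_k) ≤ δ² + 2J(z)/((k+1)·λ₀). -/
open scoped ENNReal

/-- A sequence of regularization parameters that doubles at each step is `2 ^ n * lam 0`. -/
theorem doubling_eq_two_pow_mul {lam : ℕ → ℝ≥0∞} (hlam : ∀ k, lam (k + 1) = 2 * lam k) (n : ℕ) :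
    lam n = 2 ^ n * lam 0 := by
  induction n with
  | zero => simp
  | succ n ih => rw [hlam, ih, pow_succ']; ring

/-- One minimization step does not increase the residual: compare with the trivial factor `1`. -/
theorem residual_le_of_isMin {G : Type*} [Group G] {Hres J : G → ℝ≥0∞} {c : ℝ≥0∞}
    (hc : c ≠ 0) (hc' : c ≠ ⊤) (hJ1 : J 1 = 0) {u x : G}
    (hmin : ∀ v : G, c * Hres (u * x) + J u ≤ c * Hres (v * x) + J v) :
    Hres (u * x) ≤ Hres x := by
  have h := hmin 1
  rw [one_mul, hJ1, add_zero] at h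
  exact (ENNReal.mul_le_mul_iff_right hc hc').1 (le_self_add.trans h)

/-- One minimization step controls the penalty of the remaining factor `z / x`
together with the residual: compare with the factor `z / x`. -/
theorem penalty_add_residual_le_of_isMin {G : Type*} [CommGroup G] {Hres J : G → ℝ≥0∞}
    {c : ℝ≥0∞} (hJmul : ∀ v w : G, J (v * w) ≤ J v + J w) (hJinv : ∀ v : G, J v⁻¹ = J v)
    {u x : G} (z : G)
    (hmin : ∀ v : G, c * Hres (u * x) + J u ≤ c * Hres (v * x) + J v) :
    J (z / (u * x)) + c * Hres (u * x) ≤ 2 * J (z / x) + c * Hres z := by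
  have hsplit : z / (u * x) = z / x * u⁻¹ := by
    rw [mul_comm u x, ← div_div, div_eq_mul_inv (z / x)]
  have h := hmin (z / x)
  rw [div_mul_cancel] at h
  calc J (z / (u * x)) + c * Hres (u * x)
      ≤ (J (z / x) + J u) + c * Hres (u * x) := by
        gcongr
        rw [hsplit, ← hJinv u]
        exact hJmul _ _
    _ = J (z / x) + (c * Hres (u * x) + J u) := by ring
    _ ≤ J (z / x) + (c * Hres z + J (z / x)) := by gcongr
    _ = 2 * J (z / x) + c * Hres z := by ring

/-- Multiplicative MHDM: under the penalty conditions (P)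
(`J(uv) ≤ J(u) + J(v)`, `J(1/u) = J(u)`, `J 1 = 0`) and the noise bound
`H(f^δ, f) ≤ δ²` (with `Hres v = H(f^δ, T v)` and `f = T z`), the residual satisfies
`H(f^δ, T x_k) ≤ δ² + 2 J(z) / ((k+1) λ₀)` for every `k ≥ 0`.
Here `x (k+1) = ∏_{j=0}^k u j` and `x 0 = 1` plays the role of `x₋₁`. -/
theorem mhdm_residual_estimate {G : Type*} [CommGroup G]
    (Hres J : G → ℝ≥0∞)
    (lam : ℕ → ℝ≥0∞) (hlam0 : 0 < lam 0) (hlam0top : lam 0 ≠ ⊤)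
    (hlam : ∀ k, lam (k + 1) = 2 * lam k)
    (hJmul : ∀ v w : G, J (v * w) ≤ J v + J w)
    (hJinv : ∀ v : G, J v⁻¹ = J v)
    (hJ1 : J 1 = 0)
    (u x : ℕ → G) (hx0 : x 0 = 1) (hxs : ∀ k, x (k + 1) = u k * x k)
    (z : G) (hJz : J z ≠ ⊤) (δ : ℝ≥0∞) (hδ : 0 < δ)
    (hnoise : Hres z ≤ δ ^ 2)
    (hmin : ∀ k, ∀ v : G,
      lam k * Hres (x (k + 1)) + J (u k) ≤ lam k * Hres (v * x k) + J v) :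
    ∀ k : ℕ, Hres (x (k + 1)) ≤ δ ^ 2 + 2 * J z / (((k : ℝ≥0∞) + 1) * lam 0) := by
  have hlam_pow := doubling_eq_two_pow_mul hlam
  have hne (n : ℕ) : lam n ≠ 0 := by
    rw [hlam_pow]
    exact mul_ne_zero (pow_ne_zero _ two_ne_zero) hlam0.ne'
  have htop (n : ℕ) : lam n ≠ ⊤ := by
    rw [hlam_pow]
    exact ENNReal.mul_ne_top (ENNReal.pow_ne_top ENNReal.ofNat_ne_top) hlam0top
  simp only [hxs] at hmin
  have hsum (n : ℕ) : 2 * J (z / x n) + lam n * (n * Hres (x n)) ≤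
      2 ^ n * (2 * J z) + lam n * (n * δ ^ 2) := by
    induction n with
    | zero => simp [hx0]
    | succ n ih =>
      have hmono := residual_le_of_isMin (hne n) (htop n) hJ1 (hmin n)
      have hstep := penalty_add_residual_le_of_isMin hJmul hJinv z (hmin n)
      rw [hxs, hlam]
      push_cast
      calc 2 * J (z / (u n * x n)) + 2 * lam n * ((n + 1) * Hres (u n * x n))
          = 2 * (J (z / (u n * x n)) + lam n * Hres (u n * x n)) +
              2 * (lam n * (n * Hres (u n * x n))) := by ring
        _ ≤ 2 * (2 * J (z / x n) + lam n * δ ^ 2) + 2 * (lam n * (n * Hres (x n))) := by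
            gcongr 2 * ?_ + 2 * (lam n * (n * ?_))
            exact hstep.trans (by gcongr)
        _ = 2 * (2 * J (z / x n) + lam n * (n * Hres (x n))) + 2 * lam n * δ ^ 2 := by ring
        _ ≤ 2 * (2 ^ n * (2 * J z) + lam n * (n * δ ^ 2)) + 2 * lam n * δ ^ 2 := by gcongr
        _ = 2 ^ (n + 1) * (2 * J z) + 2 * lam n * ((n + 1) * δ ^ 2) := by ring
  intro k
  set m : ℝ≥0∞ := ((k : ℝ≥0∞) + 1) * lam 0 with hm
  have hm0 : m ≠ 0 := mul_ne_zero (by simp) hlam0.ne'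
  have hmtop : m ≠ ⊤ := ENNReal.mul_ne_top (by finiteness) hlam0top
  have h := le_add_self.trans (hsum (k + 1))
  rw [hlam_pow] at h
  push_cast at h
  have hpow : (2 : ℝ≥0∞) ^ (k + 1) ≠ 0 := pow_ne_zero _ two_ne_zero
  have hpowtop : (2 : ℝ≥0∞) ^ (k + 1) ≠ ⊤ := ENNReal.pow_ne_top ENNReal.ofNat_ne_top
  rw [← ENNReal.mul_le_mul_iff_right hm0 hmtop, mul_add, ENNReal.mul_div_cancel hm0 hmtop,
    ← ENNReal.mul_le_mul_iff_right hpow hpowtop]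
  calc 2 ^ (k + 1) * (m * Hres (x (k + 1)))
      = 2 ^ (k + 1) * lam 0 * ((k + 1) * Hres (x (k + 1))) := by rw [hm]; ring
    _ ≤ 2 ^ (k + 1) * (2 * J z) + 2 ^ (k + 1) * lam 0 * ((k + 1) * δ ^ 2) := h
    _ = 2 ^ (k + 1) * (m * δ ^ 2 + 2 * J z) := by rw [hm]; ring
end

section
/- In the summed MHDM setting with a seminorm-type penalty, the residual H(f^δ, e^{y_k}) is nonincreasing in k and satisfies, for every k ≥ 0, H(f^δ, e^{y_k}) ≤ δ² + 2·J(log z)/(λ₀·(k+1)). -/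
open scoped ENNReal
open Filter

/-- A telescoping estimate: if `lam` doubles and `lam n * h n + a (n + 1)` is controlled by
`lam n * d + 2 * a n`, then the partial sums of `h` grow at most linearly with slope `d`. -/
lemma mul_sum_range_le_of_doubling {lam h a : ℕ → ℝ≥0∞} {d : ℝ≥0∞}
    (hlam : ∀ n, lam n = 2 ^ n * lam 0)
    (hstep : ∀ n, lam n * h n + a (n + 1) ≤ lam n * d + 2 * a n) (n : ℕ) :
    lam 0 * ∑ j ∈ Finset.range n, h j ≤ n * (lam 0 * d) + 2 * a 0 := by
  have key : 2 ^ n * (lam 0 * ∑ j ∈ Finset.range n, h j) + 2 * a n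
      ≤ 2 ^ n * (n * (lam 0 * d) + 2 * a 0) := by
    induction n with
    | zero => simp
    | succ n ih =>
      have hn := hstep n
      rw [hlam n] at hn
      rw [Finset.sum_range_succ]
      push_cast
      calc 2 ^ (n + 1) * (lam 0 * (∑ j ∈ Finset.range n, h j + h n)) + 2 * a (n + 1)
          = 2 * (2 ^ n * (lam 0 * ∑ j ∈ Finset.range n, h j))
            + 2 * (2 ^ n * lam 0 * h n + a (n + 1)) := by ring
        _ ≤ 2 * (2 ^ n * (lam 0 * ∑ j ∈ Finset.range n, h j))
            + 2 * (2 ^ n * lam 0 * d + 2 * a n) := by gcongr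
        _ = 2 * (2 ^ n * (lam 0 * ∑ j ∈ Finset.range n, h j) + 2 * a n)
            + 2 * (2 ^ n * lam 0 * d) := by ring
        _ ≤ 2 * (2 ^ n * (n * (lam 0 * d) + 2 * a 0)) + 2 * (2 ^ n * lam 0 * d) := by gcongr
        _ = 2 ^ (n + 1) * ((n + 1) * (lam 0 * d) + 2 * a 0) := by ring
  exact (ENNReal.mul_le_mul_iff_right (by simp) (by simp)).1 (le_self_add.trans key)

/-- Summed (Shi–Osher) MHDM: `H` is a nonnegative data fidelity, `J` is a
seminorm-type penalty (`J(v+w) ≤ J v + J w`, `J(−v) = J v`, `J 0 = 0`),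
`y (k+1) = ∑_{j=0}^k w j` (with `y 0 = 0` playing the role of `y₋₁`), each `w k`
minimizing `v ↦ λ_k H(f^δ, e^{y_{k-1}+v}) + J v`, the clean image `z > 0` satisfies
`log z ∈ dom J` and `H(f^δ, z) ≤ δ²`.  Then the residual `H(f^δ, e^{y_k})` is
nonincreasing in `k` and `H(f^δ, e^{y_k}) ≤ δ² + 2 J(log z)/(λ₀ (k+1))`. -/
theorem summed_mhdm_residual_estimate {Ω : Type*}
    (H : (Ω → ℝ) → (Ω → ℝ) → ℝ≥0∞)
    (J : (Ω → ℝ) → ℝ≥0∞)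
    (lam : ℕ → ℝ≥0∞) (hlam0 : 0 < lam 0) (hlam0top : lam 0 ≠ ⊤)
    (hlam : ∀ k, lam (k + 1) = 2 * lam k)
    (hJadd : ∀ v w : Ω → ℝ, J (v + w) ≤ J v + J w)
    (hJneg : ∀ v : Ω → ℝ, J (-v) = J v)
    (hJ0 : J 0 = 0)
    (fδ z : Ω → ℝ) (hz : ∀ t, 0 < z t)
    (hJlogz : J (fun t => Real.log (z t)) ≠ ⊤)
    (δ : ℝ≥0∞) (hδ : 0 < δ)
    (hnoise : H fδ z ≤ δ ^ 2)
    (w y : ℕ → Ω → ℝ) (hy0 : y 0 = 0) (hys : ∀ k, y (k + 1) = y k + w k)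
    (hmin : ∀ k, ∀ v : Ω → ℝ,
      lam k * H fδ (fun t => Real.exp (y (k + 1) t)) + J (w k)
        ≤ lam k * H fδ (fun t => Real.exp (y k t + v t)) + J v) :
    (Antitone fun k => H fδ (fun t => Real.exp (y (k + 1) t))) ∧
      ∀ k : ℕ, H fδ (fun t => Real.exp (y (k + 1) t))
        ≤ δ ^ 2 + 2 * J (fun t => Real.log (z t)) / (lam 0 * ((k : ℝ≥0∞) + 1)) := by
  have hpow : ∀ n, lam n = 2 ^ n * lam 0 := by
    intro n
    induction n with
    | zero => simp
    | succ n ih => rw [hlam, ih]; ring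
  have hpos : ∀ n, lam n ≠ 0 := fun n => by
    rw [hpow]; exact mul_ne_zero (by simp) hlam0.ne'
  have hfin : ∀ n, lam n ≠ ⊤ := fun n => by
    rw [hpow]; exact ENNReal.mul_ne_top (by simp) hlam0top
  have hanti : Antitone fun k => H fδ (fun t => Real.exp (y (k + 1) t)) := by
    refine antitone_nat_of_succ_le fun k => ?_
    have h := hmin (k + 1) 0
    simp only [Pi.zero_apply, add_zero, hJ0] at h
    exact (ENNReal.mul_le_mul_iff_right (hpos (k + 1)) (hfin (k + 1))).1 (le_self_add.trans h)
  refine ⟨hanti, fun k => ?_⟩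
  set l : Ω → ℝ := fun t => Real.log (z t) with hl
  have hstep : ∀ n, lam n * H fδ (fun t => Real.exp (y (n + 1) t)) + J (l - y (n + 1))
      ≤ lam n * δ ^ 2 + 2 * J (l - y n) := by
    intro n
    have hexp : (fun t => Real.exp (y n t + (l - y n) t)) = z := by
      funext t
      simp [hl, Real.exp_log (hz t)]
    have hm := hmin n (l - y n)
    rw [hexp] at hm
    have ht : J (l - y (n + 1)) ≤ J (w n) + J (l - y n) := by
      have h := hJadd (-w n) (l - y n)
      rw [hJneg] at h
      convert h using 2
      rw [hys]
      abel
    calc _ ≤ lam n * H fδ (fun t => Real.exp (y (n + 1) t)) + (J (w n) + J (l - y n)) := by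
          gcongr
      _ ≤ lam n * H fδ z + J (l - y n) + J (l - y n) := by rw [← add_assoc]; gcongr
      _ ≤ lam n * δ ^ 2 + J (l - y n) + J (l - y n) := by gcongr
      _ = _ := by ring
  have hsum := mul_sum_range_le_of_doubling
    (h := fun n => H fδ (fun t => Real.exp (y (n + 1) t))) (a := fun n => J (l - y n))
    hpow hstep (k + 1)
  have hcard : ((k : ℝ≥0∞) + 1) * H fδ (fun t => Real.exp (y (k + 1) t))
      ≤ ∑ j ∈ Finset.range (k + 1), H fδ (fun t => Real.exp (y (j + 1) t)) := by
    have h := Finset.card_nsmul_le_sum (Finset.range (k + 1))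
      (fun j => H fδ (fun t => Real.exp (y (j + 1) t))) _
      fun j hj => hanti (Nat.lt_succ_iff.1 (Finset.mem_range.1 hj))
    simpa using h
  have hc0 : lam 0 * ((k : ℝ≥0∞) + 1) ≠ 0 := mul_ne_zero hlam0.ne' (by simp)
  have hct : lam 0 * ((k : ℝ≥0∞) + 1) ≠ ⊤ := ENNReal.mul_ne_top hlam0top (by simp)
  refine (ENNReal.mul_le_mul_iff_right hc0 hct).1 ?_
  rw [mul_add _ (δ ^ 2), ENNReal.mul_div_cancel hc0 hct, mul_assoc]
  refine (mul_le_mul_right hcard (lam 0)).trans (hsum.trans_eq ?_)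
  simp only [hy0, sub_zero]
  push_cast
  ring
end

section
/- Assume the penalty conditions (P), the noise bound H(f^δ, f) ≤ δ² for each δ, and that the multiplicative MHDM iterates u_k with partial products x_k are well-defined for each noise level. If (δ_n) is a sequence of noise levels with δ_n → 0 and the corresponding discrepancy stopping indices satisfy k*(δ_n) → ∞, then H(f^{δ_n}, T x_{k*(δ_n)}) → 0 as n → ∞. -/
open scoped ENNReal
open Filter

/-- Summed error estimate for multiplicative multiscale minimization: the weighted residual of the
`m`-th partial product is controlled by the penalty and the residual of any competitor `z`. -/
theorem mhdm_error_add_residual_le {G : Type*} [CommGroup G]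
    {J : G → ℝ≥0∞} {lam : ℕ → ℝ≥0∞} (hlam : ∀ k, lam (k + 1) = 2 * lam k)
    (hJmul : ∀ v w : G, J (v * w) ≤ J v + J w) (hJinv : ∀ v : G, J v⁻¹ = J v) (hJ1 : J 1 = 0)
    {H : G → ℝ≥0∞} {u x : ℕ → G} (hx0 : x 0 = 1) (hxs : ∀ k, x (k + 1) = u k * x k)
    (hmin : ∀ k, ∀ v : G, lam k * H (x (k + 1)) + J (u k) ≤ lam k * H (v * x k) + J v)
    (z : G) (m : ℕ) :
    2 * J (z / x m) + m * (lam m * H (x m)) ≤ 2 ^ (m + 1) * J z + m * (lam m * H z) := by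
  induction m with
  | zero => simp [hx0]
  | succ m ih =>
    have hmono : lam m * H (x (m + 1)) ≤ lam m * H (x m) := by
      have h := hmin m 1
      rw [one_mul, hJ1, add_zero] at h
      exact le_self_add.trans h
    have hcomp : lam m * H (x (m + 1)) + J (u m) ≤ lam m * H z + J (z / x m) := by
      simpa using hmin m (z / x m)
    have herr : J (z / x (m + 1)) ≤ J (z / x m) + J (u m) := by
      have h := hJmul (z / x m) (u m)⁻¹
      rwa [hJinv, ← div_eq_mul_inv, div_div, mul_comm (x m), ← hxs] at h
    have hstep : J (z / x (m + 1)) + lam m * H (x (m + 1)) ≤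
        2 * J (z / x m) + lam m * H z :=
      calc J (z / x (m + 1)) + lam m * H (x (m + 1))
          ≤ J (z / x m) + J (u m) + lam m * H (x (m + 1)) := by gcongr
        _ = J (z / x m) + (lam m * H (x (m + 1)) + J (u m)) := by ring
        _ ≤ J (z / x m) + (lam m * H z + J (z / x m)) := by gcongr
        _ = 2 * J (z / x m) + lam m * H z := by ring
    rw [hlam]
    push_cast
    calc 2 * J (z / x (m + 1)) + (m + 1) * (2 * lam m * H (x (m + 1)))
        = 2 * (J (z / x (m + 1)) + lam m * H (x (m + 1))) +
            2 * (m * (lam m * H (x (m + 1)))) := by ring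
      _ ≤ 2 * (2 * J (z / x m) + lam m * H z) + 2 * (m * (lam m * H (x m))) := by gcongr
      _ = 2 * (2 * J (z / x m) + m * (lam m * H (x m))) + 2 * (lam m * H z) := by ring
      _ ≤ 2 * (2 ^ (m + 1) * J z + m * (lam m * H z)) + 2 * (lam m * H z) := by gcongr
      _ = 2 ^ (m + 1 + 1) * J z + (m + 1) * (2 * lam m * H z) := by ring

/-- The residual of the multiplicative multiscale iterates exceeds that of a competitor `z` by at
most `O(1 / m)`. -/
theorem mhdm_residual_le {G : Type*} [CommGroup G]
    {J : G → ℝ≥0∞} {lam : ℕ → ℝ≥0∞} (hlam0 : lam 0 ≠ 0) (hlam0top : lam 0 ≠ ⊤)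
    (hlam : ∀ k, lam (k + 1) = 2 * lam k)
    (hJmul : ∀ v w : G, J (v * w) ≤ J v + J w) (hJinv : ∀ v : G, J v⁻¹ = J v) (hJ1 : J 1 = 0)
    {H : G → ℝ≥0∞} {u x : ℕ → G} (hx0 : x 0 = 1) (hxs : ∀ k, x (k + 1) = u k * x k)
    (hmin : ∀ k, ∀ v : G, lam k * H (x (k + 1)) + J (u k) ≤ lam k * H (v * x k) + J v)
    (z : G) {m : ℕ} (hm : m ≠ 0) :
    H (x m) ≤ 2 * J z / lam 0 / m + H z := by
  have hpow : ∀ k, lam k = 2 ^ k * lam 0 := fun k => by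
    induction k with
    | zero => simp
    | succ k ih => rw [hlam, ih]; ring
  have h := le_add_self.trans
    (mhdm_error_add_residual_le hlam hJmul hJinv hJ1 hx0 hxs hmin z m)
  have hm0 : (m : ℝ≥0∞) ≠ 0 := by exact_mod_cast hm
  have hmtop : (m : ℝ≥0∞) ≠ ⊤ := ENNReal.natCast_ne_top m
  have hc0 : (2 : ℝ≥0∞) ^ m * (lam 0 * m) ≠ 0 := by simp [hlam0, hm]
  have hctop : (2 : ℝ≥0∞) ^ m * (lam 0 * m) ≠ ⊤ := by finiteness
  rw [← ENNReal.mul_le_mul_iff_right hc0 hctop]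
  have hcancel : lam 0 * m * (2 * J z / lam 0 / m) = 2 * J z := by
    rw [mul_assoc, ENNReal.mul_div_cancel hm0 hmtop, ENNReal.mul_div_cancel hlam0 hlam0top]
  calc 2 ^ m * (lam 0 * m) * H (x m) = m * (lam m * H (x m)) := by rw [hpow m]; ring
    _ ≤ 2 ^ (m + 1) * J z + m * (lam m * H z) := h
    _ = 2 ^ m * (2 * J z) + 2 ^ m * (lam 0 * m) * H z := by rw [hpow m]; ring
    _ = 2 ^ m * (lam 0 * m) * (2 * J z / lam 0 / m + H z) := by
      rw [mul_add, mul_assoc _ (lam 0 * _) (_ / _), hcancel]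

/-- Multiplicative MHDM discrepancy principle, convergence of the stopped residual:
for a sequence of noise levels `δ n → 0` with corresponding data fidelities
`Hres n v = H(f^{δ_n}, T v)`, iterates `u n`, partial products `x n` and discrepancy
stopping indices `kstar n = max{k : H(f^{δ_n}, T x_k) ≥ τ (δ n)²}`, if
`kstar n → ∞` then `H(f^{δ_n}, T x_{k*(δ_n)}) → 0`. -/
theorem mhdm_stopped_residual_tendsto_zero {G : Type*} [CommGroup G]
    (J : G → ℝ≥0∞)
    (lam : ℕ → ℝ≥0∞) (hlam0 : 0 < lam 0) (hlam0top : lam 0 ≠ ⊤)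
    (hlam : ∀ k, lam (k + 1) = 2 * lam k)
    (hJmul : ∀ v w : G, J (v * w) ≤ J v + J w)
    (hJinv : ∀ v : G, J v⁻¹ = J v)
    (hJ1 : J 1 = 0)
    (z : G) (hJz : J z ≠ ⊤)
    (τ : ℝ≥0∞) (hτ : 1 < τ) (hτtop : τ ≠ ⊤)
    (δ : ℕ → ℝ≥0∞) (hδpos : ∀ n, 0 < δ n) (hδtop : ∀ n, δ n ≠ ⊤)
    (Hres : ℕ → G → ℝ≥0∞)
    (u x : ℕ → ℕ → G)
    (hx0 : ∀ n, x n 0 = 1) (hxs : ∀ n k, x n (k + 1) = u n k * x n k)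
    (hnoise : ∀ n, Hres n z ≤ δ n ^ 2)
    (hmin : ∀ n k, ∀ v : G,
      lam k * Hres n (x n (k + 1)) + J (u n k) ≤ lam k * Hres n (v * x n k) + J v)
    (kstar : ℕ → ℕ)
    (hkstar : ∀ n, kstar n = sSup {k : ℕ | τ * δ n ^ 2 ≤ Hres n (x n (k + 1))})
    (hδ0 : Tendsto δ atTop (nhds 0))
    (hkinf : Tendsto kstar atTop atTop) :
    Tendsto (fun n => Hres n (x n (kstar n + 1))) atTop (nhds 0) := by
  have hbound : ∀ n, Hres n (x n (kstar n + 1)) ≤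
      2 * J z / lam 0 / ((kstar n + 1 : ℕ) : ℝ≥0∞) + δ n ^ 2 := fun n =>
    (mhdm_residual_le hlam0.ne' hlam0top hlam hJmul hJinv hJ1 (hx0 n) (hxs n) (hmin n) z
      (Nat.succ_ne_zero _)).trans (by gcongr; exact hnoise n)
  have hC : 2 * J z / lam 0 ≠ ⊤ := ENNReal.div_ne_top (by finiteness) hlam0.ne'
  have hk : Tendsto (fun n => ((kstar n + 1 : ℕ) : ℝ≥0∞)) atTop (nhds ⊤) :=
    ENNReal.tendsto_nat_nhds_top.comp ((tendsto_add_atTop_nat 1).comp hkinf)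
  have h1 : Tendsto (fun n => 2 * J z / lam 0 / ((kstar n + 1 : ℕ) : ℝ≥0∞)) atTop (nhds 0) := by
    simpa using ENNReal.Tendsto.const_div hk (Or.inr hC)
  have h2 : Tendsto (fun n => δ n ^ 2) atTop (nhds 0) := by
    simpa using ENNReal.Tendsto.pow (n := 2) hδ0
  exact tendsto_of_tendsto_of_tendsto_of_le_of_le tendsto_const_nhds
    (by simpa using h1.add h2) (fun _ => zero_le) hbound
end

section
/- Let (Ω, μ) be a measure space and let f, f^{δ_n}, g_n : Ω → (0,∞) be measurable with f finite a.e. If ∫_Ω (f^{δ_n}/g_n − 1)² dμ → 0 and ∫_Ω (f^{δ_n}/f − 1)² dμ → 0 as n → ∞, then there exists a subsequence (g_{n_j}) converging to f almost everywhere on Ω. -/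
open MeasureTheory Filter

/-- Nonnegative measurable functions whose integrals tend to zero have a subsequence tending to
zero almost everywhere. -/
theorem exists_subseq_tendsto_zero_ae_of_lintegral {Ω : Type*} [MeasurableSpace Ω]
    {μ : Measure Ω} {w : ℕ → Ω → ℝ} (hw : ∀ n, Measurable (w n)) (hw0 : ∀ n t, 0 ≤ w n t)
    (h : Tendsto (fun n => ∫⁻ t, ENNReal.ofReal (w n t) ∂μ) atTop (nhds 0)) :
    ∃ φ : ℕ → ℕ, StrictMono φ ∧ ∀ᵐ t ∂μ, Tendsto (fun j => w (φ j) t) atTop (nhds 0) := by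
  have hm : TendstoInMeasure μ w atTop (fun _ => 0) := by
    refine tendstoInMeasure_of_tendsto_eLpNorm one_ne_zero
      (fun n => (hw n).aestronglyMeasurable) aestronglyMeasurable_const ?_
    refine h.congr fun n => ?_
    rw [eLpNorm_one_eq_lintegral_enorm]
    refine lintegral_congr fun t => ?_
    simp [Real.enorm_eq_ofReal (hw0 n t)]
  exact hm.exists_seq_tendsto_ae

theorem tendsto_one_of_sq_sub_one_le {ι : Type*} {l : Filter ι} {a w : ι → ℝ}
    (hle : ∀ i, (a i - 1) ^ 2 ≤ w i) (hw : Tendsto w l (nhds 0)) : Tendsto a l (nhds 1) := by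
  have hsq : Tendsto (fun i => (a i - 1) ^ 2) l (nhds 0) :=
    squeeze_zero (fun i => sq_nonneg _) hle hw
  have habs : Tendsto (fun i => |a i - 1|) l (nhds 0) := by
    simpa [Real.sqrt_sq_eq_abs] using hsq.sqrt
  simpa using ((tendsto_zero_iff_abs_tendsto_zero _).2 habs).add_const 1

/-- If the quadratic (Rudin–Osher) residuals `∫ (f^{δ_n}/g_n − 1)² dμ → 0` and the
noise fidelities `∫ (f^{δ_n}/f − 1)² dμ → 0`, where `f, f^{δ_n}, g_n : Ω → (0,∞)` are
measurable, then a subsequence of `(g_n)` converges to `f` almost everywhere. -/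
theorem quadratic_fidelity_ae_subseq_convergence {Ω : Type*} [MeasurableSpace Ω]
    (μ : Measure Ω)
    (f : Ω → ℝ) (fδ g : ℕ → Ω → ℝ)
    (hf_meas : Measurable f) (hfδ_meas : ∀ n, Measurable (fδ n))
    (hg_meas : ∀ n, Measurable (g n))
    (hf_pos : ∀ t, 0 < f t) (hfδ_pos : ∀ n t, 0 < fδ n t) (hg_pos : ∀ n t, 0 < g n t)
    (h1 : Tendsto (fun n => ∫⁻ t, ENNReal.ofReal ((fδ n t / g n t - 1) ^ 2) ∂μ)
      atTop (nhds 0))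
    (h2 : Tendsto (fun n => ∫⁻ t, ENNReal.ofReal ((fδ n t / f t - 1) ^ 2) ∂μ)
      atTop (nhds 0)) :
    ∃ φ : ℕ → ℕ, StrictMono φ ∧
      ∀ᵐ t ∂μ, Tendsto (fun j => g (φ j) t) atTop (nhds (f t)) := by
  have hm1 : ∀ n, Measurable fun t => (fδ n t / g n t - 1) ^ 2 := fun n =>
    (((hfδ_meas n).div (hg_meas n)).sub_const 1).pow_const 2
  have hm2 : ∀ n, Measurable fun t => (fδ n t / f t - 1) ^ 2 := fun n =>
    (((hfδ_meas n).div hf_meas).sub_const 1).pow_const 2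
  obtain ⟨φ, hφ, hae⟩ := exists_subseq_tendsto_zero_ae_of_lintegral (μ := μ)
    (w := fun n t => (fδ n t / g n t - 1) ^ 2 + (fδ n t / f t - 1) ^ 2)
    (fun n => (hm1 n).add (hm2 n)) (fun n t => by positivity) (by
      have h12 := h1.add h2
      rw [add_zero] at h12
      refine h12.congr fun n => ?_
      rw [← lintegral_add_left (hm1 n).ennreal_ofReal]
      exact lintegral_congr fun t => (ENNReal.ofReal_add (sq_nonneg _) (sq_nonneg _)).symm)
  refine ⟨φ, hφ, hae.mono fun t ht => ?_⟩
  have hg1 : Tendsto (fun j => fδ (φ j) t / g (φ j) t) atTop (nhds 1) :=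
    tendsto_one_of_sq_sub_one_le (fun j => le_add_of_nonneg_right (sq_nonneg _)) ht
  have hf1 : Tendsto (fun j => fδ (φ j) t / f t) atTop (nhds 1) :=
    tendsto_one_of_sq_sub_one_le (fun j => le_add_of_nonneg_left (sq_nonneg _)) ht
  have hlim := (hf1.div hg1 one_ne_zero).const_mul (f t)
  rw [div_one, mul_one] at hlim
  refine hlim.congr fun j => ?_
  have hf0 := (hf_pos t).ne'
  have hδ0 := (hfδ_pos (φ j) t).ne'
  have hg0 := (hg_pos (φ j) t).ne'
  simp only [Pi.div_apply]
  field_simp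
end

section
/- Let (Ω, μ) be a measure space, let d(a,b) = a/b + log b − log a − 1 for a, b > 0, and let f, f^{δ_n}, g_n : Ω → (0,∞) be measurable with f finite a.e. If ∫_Ω d(f^{δ_n}, g_n) dμ → 0 and ∫_Ω d(f^{δ_n}, f) dμ → 0 as n → ∞, then there exists a subsequence (g_{n_j}) converging to f almost everywhere on Ω. -/
open MeasureTheory Filter

/-- The function `x ↦ x - 1 - log x` dominates `(√x - 1) ^ 2` on the positive reals. -/
lemma sq_sqrt_sub_one_le_sub_one_sub_log {x : ℝ} (hx : 0 < x) :
    (√x - 1) ^ 2 ≤ x - 1 - Real.log x := by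
  have h := Real.log_le_sub_one_of_pos (Real.sqrt_pos.mpr hx)
  rw [Real.log_sqrt hx.le] at h
  nlinarith [Real.sq_sqrt hx.le]

/-- If `x - 1 - log x` tends to zero along positive reals, then `x` tends to one. -/
lemma tendsto_one_of_tendsto_sub_one_sub_log {ι : Type*} {l : Filter ι} {x : ι → ℝ}
    (hx : ∀ i, 0 < x i) (h : Tendsto (fun i => x i - 1 - Real.log (x i)) l (nhds 0)) :
    Tendsto x l (nhds 1) := by
  have hsq : Tendsto (fun i => (√(x i) - 1) ^ 2) l (nhds 0) :=
    squeeze_zero (fun i => sq_nonneg _)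
      (fun i => sq_sqrt_sub_one_le_sub_one_sub_log (hx i)) h
  have habs : Tendsto (fun i => |√(x i) - 1|) l (nhds 0) := by
    simpa [Real.sqrt_sq_eq_abs] using hsq.sqrt
  have hsqrt : Tendsto (fun i => √(x i)) l (nhds 1) := by
    simpa using ((tendsto_zero_iff_abs_tendsto_zero _).mpr habs).add_const 1
  simpa [Real.sq_sqrt (hx _).le] using hsqrt.pow 2

/-- If the Itakura–Saito residuals `∫ d(f^{δ_n}, g_n) dμ → 0` and the noise
fidelities `∫ d(f^{δ_n}, f) dμ → 0`, where `d(a,b) = a/b + log b − log a − 1` and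
`f, f^{δ_n}, g_n : Ω → (0,∞)` are measurable, then a subsequence of `(g_n)`
converges to `f` almost everywhere. -/
theorem itakura_saito_fidelity_ae_subseq_convergence {Ω : Type*} [MeasurableSpace Ω]
    (μ : Measure Ω)
    (d : ℝ → ℝ → ℝ)
    (hd : ∀ a b : ℝ, d a b = a / b + Real.log b - Real.log a - 1)
    (f : Ω → ℝ) (fδ g : ℕ → Ω → ℝ)
    (hf_meas : Measurable f) (hfδ_meas : ∀ n, Measurable (fδ n))
    (hg_meas : ∀ n, Measurable (g n))
    (hf_pos : ∀ t, 0 < f t) (hfδ_pos : ∀ n t, 0 < fδ n t) (hg_pos : ∀ n t, 0 < g n t)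
    (h1 : Tendsto (fun n => ∫⁻ t, ENNReal.ofReal (d (fδ n t) (g n t)) ∂μ)
      atTop (nhds 0))
    (h2 : Tendsto (fun n => ∫⁻ t, ENNReal.ofReal (d (fδ n t) (f t)) ∂μ)
      atTop (nhds 0)) :
    ∃ φ : ℕ → ℕ, StrictMono φ ∧
      ∀ᵐ t ∂μ, Tendsto (fun j => g (φ j) t) atTop (nhds (f t)) := by
  have hd_eq : ∀ a b, 0 < a → 0 < b → d a b = a / b - 1 - Real.log (a / b) := by
    intro a b ha hb
    rw [hd, Real.log_div ha.ne' hb.ne']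
    ring
  have hd_nonneg : ∀ a b, 0 < a → 0 < b → 0 ≤ d a b := by
    intro a b ha hb
    rw [hd_eq a b ha hb]
    exact (sq_nonneg _).trans (sq_sqrt_sub_one_le_sub_one_sub_log (div_pos ha hb))
  have hd_meas : ∀ u v : Ω → ℝ, Measurable u → Measurable v →
      Measurable fun t => d (u t) (v t) := by
    intro u v hu hv
    simp only [hd]
    fun_prop
  let D : ℕ → Ω → ℝ := fun n t => d (fδ n t) (g n t) + d (fδ n t) (f t)
  have hD_meas : ∀ n, Measurable (D n) := fun n =>
    (hd_meas _ _ (hfδ_meas n) (hg_meas n)).add (hd_meas _ _ (hfδ_meas n) hf_meas)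
  have hg_nonneg : ∀ n t, 0 ≤ d (fδ n t) (g n t) := fun n t =>
    hd_nonneg _ _ (hfδ_pos n t) (hg_pos n t)
  have hf_nonneg : ∀ n t, 0 ≤ d (fδ n t) (f t) := fun n t =>
    hd_nonneg _ _ (hfδ_pos n t) (hf_pos t)
  have hD_norm : ∀ n, eLpNorm (D n - fun _ => (0 : ℝ)) 1 μ =
      ∫⁻ t, ENNReal.ofReal (d (fδ n t) (g n t)) ∂μ +
        ∫⁻ t, ENNReal.ofReal (d (fδ n t) (f t)) ∂μ := by
    intro n
    rw [eLpNorm_one_eq_lintegral_enorm,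
      ← lintegral_add_left (hd_meas _ _ (hfδ_meas n) (hg_meas n)).ennreal_ofReal]
    refine lintegral_congr fun t => ?_
    rw [Pi.sub_apply, sub_zero,
      Real.enorm_of_nonneg (add_nonneg (hg_nonneg n t) (hf_nonneg n t)),
      ENNReal.ofReal_add (hg_nonneg n t) (hf_nonneg n t)]
  have hD_lim : Tendsto (fun n => eLpNorm (D n - fun _ => (0 : ℝ)) 1 μ) atTop (nhds 0) := by
    simp only [hD_norm]
    simpa using h1.add h2
  obtain ⟨φ, hφ, hae⟩ := (tendstoInMeasure_of_tendsto_eLpNorm one_ne_zero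
    (fun n => (hD_meas n).aestronglyMeasurable) aestronglyMeasurable_const
    hD_lim).exists_seq_tendsto_ae
  refine ⟨φ, hφ, ?_⟩
  filter_upwards [hae] with t ht
  have hg_ratio : Tendsto (fun j => fδ (φ j) t / g (φ j) t) atTop (nhds 1) := by
    refine tendsto_one_of_tendsto_sub_one_sub_log
      (fun j => div_pos (hfδ_pos _ t) (hg_pos _ t)) ?_
    simp only [← hd_eq _ _ (hfδ_pos _ t) (hg_pos _ t)]
    exact squeeze_zero (fun j => hg_nonneg _ t)
      (fun j => le_add_of_nonneg_right (hf_nonneg (φ j) t)) ht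
  have hf_ratio : Tendsto (fun j => fδ (φ j) t / f t) atTop (nhds 1) := by
    refine tendsto_one_of_tendsto_sub_one_sub_log
      (fun j => div_pos (hfδ_pos _ t) (hf_pos t)) ?_
    simp only [← hd_eq _ _ (hfδ_pos _ t) (hf_pos t)]
    exact squeeze_zero (fun j => hf_nonneg _ t)
      (fun j => le_add_of_nonneg_left (hg_nonneg (φ j) t)) ht
  have hlim := (hf_ratio.div hg_ratio one_ne_zero).const_mul (f t)
  rw [div_one, mul_one] at hlim
  refine hlim.congr fun j => ?_
  have := (hfδ_pos (φ j) t).ne'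
  have := (hg_pos (φ j) t).ne'
  have := (hf_pos t).ne'
  simp only [Pi.div_apply]
  field_simp
end

section
/- Assume J(1) = 0 and that the tight multiplicative MHDM iterates u_k with partial products x_k are well-defined. Then for every k ≥ 0 one has λ_k·H(f^δ, T x_k) + λ_k a_k·J(x_k) + J(u_k) ≤ λ_k·H(f^δ, T x_{k-1}) + λ_k a_k·J(x_{k-1}); consequently, since (a_k) is nonincreasing, the tight residual k ↦ H(f^δ, T x_k) + a_k·J(x_k) is nonincreasing. -/
open scoped ENNReal
open Filter

/-- Tight multiplicative MHDM: `Hres v = H(f^δ, T v)`, partial products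
`x (k+1) = ∏_{j=0}^k u j` with `x 0 = 1` (playing the role of `x₋₁`), parameters
`λ₀ > 0`, `2λ_k ≤ λ_{k+1}`, and a nonincreasing null sequence `(a_k)` of nonnegative
numbers; each `u k` minimizes
`v ↦ λ_k H(f^δ, T(v x_{k-1})) + λ_k a_k J(v x_{k-1}) + J v`.  If `J 1 = 0`, then for
every `k ≥ 0`,
`λ_k H(f^δ, T x_k) + λ_k a_k J(x_k) + J(u_k) ≤ λ_k H(f^δ, T x_{k-1}) + λ_k a_k J(x_{k-1})`,
and consequently the tight residual `k ↦ H(f^δ, T x_k) + a_k J(x_k)` is nonincreasing. -/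
theorem tight_mhdm_residual_monotone {G : Type*} [CommGroup G]
    (Hres J : G → ℝ≥0∞)
    (lam : ℕ → ℝ≥0∞) (hlam0 : 0 < lam 0) (hlamtop : ∀ k, lam k ≠ ⊤)
    (hlam : ∀ k, 2 * lam k ≤ lam (k + 1))
    (a : ℕ → ℝ≥0∞) (hatop : ∀ k, a k ≠ ⊤)
    (ha_anti : ∀ k, a (k + 1) ≤ a k) (ha0 : Tendsto a atTop (nhds 0))
    (u x : ℕ → G) (hx0 : x 0 = 1) (hxs : ∀ k, x (k + 1) = u k * x k)
    (hJ1 : J 1 = 0)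
    (hmin : ∀ k, ∀ v : G,
      lam k * Hres (x (k + 1)) + lam k * a k * J (x (k + 1)) + J (u k)
        ≤ lam k * Hres (v * x k) + lam k * a k * J (v * x k) + J v) :
    (∀ k, lam k * Hres (x (k + 1)) + lam k * a k * J (x (k + 1)) + J (u k)
        ≤ lam k * Hres (x k) + lam k * a k * J (x k)) ∧
      Antitone (fun k => Hres (x (k + 1)) + a k * J (x (k + 1))) := by
  have step : ∀ k, lam k * Hres (x (k + 1)) + lam k * a k * J (x (k + 1)) + J (u k)
      ≤ lam k * Hres (x k) + lam k * a k * J (x k) := fun k => by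
    simpa [hJ1] using hmin k 1
  have lam_pos : ∀ k, 0 < lam k := fun k => by
    induction k with
    | zero => exact hlam0
    | succ k ih => exact (ENNReal.mul_pos two_ne_zero ih.ne').trans_le (hlam k)
  refine ⟨step, antitone_nat_of_succ_le fun k => ?_⟩
  have h : lam (k + 1) * (Hres (x (k + 2)) + a (k + 1) * J (x (k + 2)))
      ≤ lam (k + 1) * (Hres (x (k + 1)) + a (k + 1) * J (x (k + 1))) := by
    simpa only [mul_add, mul_assoc] using le_self_add.trans (step (k + 1))
  calc Hres (x (k + 2)) + a (k + 1) * J (x (k + 2))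
      ≤ Hres (x (k + 1)) + a (k + 1) * J (x (k + 1)) :=
        (ENNReal.mul_le_mul_iff_right (lam_pos (k + 1)).ne' (hlamtop (k + 1))).1 h
    _ ≤ Hres (x (k + 1)) + a k * J (x (k + 1)) := by gcongr; exact ha_anti k
end

section
/- Assume the penalty conditions (P), the noise bound H(f^δ, f) ≤ δ², and that the tight multiplicative MHDM iterates u_k with partial products x_k are well-defined. Then for every k ≥ 0, H(f^δ, T x_k) + a_k·J(x_k) ≤ δ² + (∑_{j=0}^k a_j)·J(z)/(k+1) + 2J(z)/((k+1)·λ₀). -/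
open scoped ENNReal
open Filter

/-- Tight multiplicative MHDM estimate: under the penalty conditions (P)
(`J(vw) ≤ J v + J w`, `J(v⁻¹) = J v`, `J 1 = 0`) and the noise bound
`H(f^δ, f) ≤ δ²` (with `Hres v = H(f^δ, T v)`, `f = T z`), for every `k ≥ 0`,
`H(f^δ, T x_k) + a_k J(x_k) ≤ δ² + (∑_{j=0}^k a_j) J(z)/(k+1) + 2 J(z)/((k+1) λ₀)`.
Here `x (k+1) = ∏_{j=0}^k u j` and `x 0 = 1` plays the role of `x₋₁`. -/
theorem tight_mhdm_residual_estimate {G : Type*} [CommGroup G]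
    (Hres J : G → ℝ≥0∞)
    (lam : ℕ → ℝ≥0∞) (hlam0 : 0 < lam 0) (hlamtop : ∀ k, lam k ≠ ⊤)
    (hlam : ∀ k, 2 * lam k ≤ lam (k + 1))
    (a : ℕ → ℝ≥0∞) (hatop : ∀ k, a k ≠ ⊤)
    (ha_anti : ∀ k, a (k + 1) ≤ a k) (ha0 : Tendsto a atTop (nhds 0))
    (hJmul : ∀ v w : G, J (v * w) ≤ J v + J w)
    (hJinv : ∀ v : G, J v⁻¹ = J v)
    (hJ1 : J 1 = 0)
    (u x : ℕ → G) (hx0 : x 0 = 1) (hxs : ∀ k, x (k + 1) = u k * x k)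
    (z : G) (hJz : J z ≠ ⊤)
    (δ : ℝ≥0∞) (hδ : 0 < δ)
    (hnoise : Hres z ≤ δ ^ 2)
    (hmin : ∀ k, ∀ v : G,
      lam k * Hres (x (k + 1)) + lam k * a k * J (x (k + 1)) + J (u k)
        ≤ lam k * Hres (v * x k) + lam k * a k * J (v * x k) + J v) :
    ∀ k : ℕ, Hres (x (k + 1)) + a k * J (x (k + 1))
      ≤ δ ^ 2 + (∑ j ∈ Finset.range (k + 1), a j) * J z / ((k : ℝ≥0∞) + 1)
        + 2 * J z / (((k : ℝ≥0∞) + 1) * lam 0) := by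
  have hlampos : ∀ k, lam k ≠ 0 := by
    intro k
    induction k with
    | zero => exact hlam0.ne'
    | succ k ih =>
      intro h
      have h' := hlam k
      rw [h, nonpos_iff_eq_zero, mul_eq_zero] at h'
      exact h'.elim two_ne_zero ih
  set F : ℕ → ℝ≥0∞ := fun k => Hres (x (k + 1)) + a k * J (x (k + 1)) with hF
  have hF_anti : Antitone F := by
    refine antitone_nat_of_succ_le fun k => ?_
    have h := hmin (k + 1) 1
    rw [one_mul, hJ1, add_zero, mul_assoc, mul_assoc, ← mul_add, ← mul_add] at h
    have h' := (ENNReal.mul_le_mul_iff_right (hlampos (k + 1)) (hlamtop (k + 1))).1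
      (le_self_add.trans h)
    refine h'.trans ?_
    simp only [hF]
    gcongr
    exact ha_anti k
  have hstep : ∀ k, F k + 2 * J (z * (x (k + 1))⁻¹) / lam (k + 1)
      ≤ (δ ^ 2 + a k * J z) + 2 * J (z * (x k)⁻¹) / lam k := by
    intro k
    have h := hmin k (z * (x k)⁻¹)
    rw [inv_mul_cancel_right, mul_assoc, mul_assoc, ← mul_add, ← mul_add] at h
    have hE : J (z * (x (k + 1))⁻¹) ≤ J (z * (x k)⁻¹) + J (u k) := by
      rw [hxs, mul_inv_rev, ← mul_assoc, ← hJinv (u k)]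
      exact hJmul _ _
    have hdiv : 2 * J (z * (x (k + 1))⁻¹) / lam (k + 1) ≤ J (z * (x (k + 1))⁻¹) / lam k :=
      calc 2 * J (z * (x (k + 1))⁻¹) / lam (k + 1)
          ≤ 2 * J (z * (x (k + 1))⁻¹) / (2 * lam k) := ENNReal.div_le_div_left (hlam k) _
        _ = J (z * (x (k + 1))⁻¹) / lam k :=
          ENNReal.mul_div_mul_left _ _ two_ne_zero ENNReal.ofNat_ne_top
    refine (add_le_add_right hdiv _).trans ?_
    rw [← ENNReal.mul_le_mul_iff_right (hlampos k) (hlamtop k),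
      mul_add _ (F k), mul_add _ (δ ^ 2 + a k * J z),
      ENNReal.mul_div_cancel (hlampos k) (hlamtop k),
      ENNReal.mul_div_cancel (hlampos k) (hlamtop k)]
    calc lam k * F k + J (z * (x (k + 1))⁻¹)
        ≤ lam k * F k + (J (z * (x k)⁻¹) + J (u k)) := by gcongr
      _ = (lam k * F k + J (u k)) + J (z * (x k)⁻¹) := by ring
      _ ≤ (lam k * (Hres z + a k * J z) + J (z * (x k)⁻¹)) + J (z * (x k)⁻¹) := by
          gcongr
      _ ≤ (lam k * (δ ^ 2 + a k * J z) + J (z * (x k)⁻¹)) + J (z * (x k)⁻¹) := by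
          gcongr
      _ = lam k * (δ ^ 2 + a k * J z) + 2 * J (z * (x k)⁻¹) := by ring
  have hsum : ∀ k, ∑ j ∈ Finset.range k, F j + 2 * J (z * (x k)⁻¹) / lam k
      ≤ ∑ j ∈ Finset.range k, (δ ^ 2 + a j * J z) + 2 * J z / lam 0 := by
    intro k
    induction k with
    | zero => simp [hx0]
    | succ k ih =>
      rw [Finset.sum_range_succ, Finset.sum_range_succ, add_assoc]
      refine (add_le_add_right (hstep k) _).trans ?_
      rw [add_left_comm, add_right_comm _ (δ ^ 2 + a k * J z), add_comm (δ ^ 2 + a k * J z)]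
      exact add_le_add_left ih _
  intro k
  have hn0 : (k : ℝ≥0∞) + 1 ≠ 0 := by simp
  have hntop : (k : ℝ≥0∞) + 1 ≠ ⊤ := by simp
  change F k ≤ _
  rw [← ENNReal.mul_le_mul_iff_right hn0 hntop, mul_add _ (δ ^ 2 + _), mul_add _ (δ ^ 2),
    ENNReal.mul_div_cancel hn0 hntop]
  have hlast : ((k : ℝ≥0∞) + 1) * (2 * J z / (((k : ℝ≥0∞) + 1) * lam 0)) = 2 * J z / lam 0 := by
    rw [← mul_div_assoc, ENNReal.mul_div_mul_left _ _ hn0 hntop]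
  rw [hlast]
  calc ((k : ℝ≥0∞) + 1) * F k = ∑ _j ∈ Finset.range (k + 1), F k := by simp
    _ ≤ ∑ j ∈ Finset.range (k + 1), F j :=
        Finset.sum_le_sum fun j hj => hF_anti (Nat.lt_succ_iff.1 (Finset.mem_range.1 hj))
    _ ≤ _ := le_self_add.trans (hsum (k + 1))
    _ = _ := by simp [Finset.sum_add_distrib, Finset.sum_mul]
end

section
/- Assume the penalty conditions (P), the noise bound H(f^δ, f) ≤ δ², that the tight multiplicative MHDM iterates u_k with partial products x_k are well-defined, and additionally that ∑_{k=0}^∞ a_k < ∞. For τ > 1, the tight discrepancy stopping index k*(δ) := max{k ∈ ℕ : H(f^δ, T x_k) + a_k·J(x_k) ≥ τδ²} is finite; moreover, if (δ_n) is a sequence of noise levels with δ_n → 0 and k*(δ_n) → ∞, then H(f^{δ_n}, T x_{k*(δ_n)}) → 0 and a_{k*(δ_n)}·J(x_{k*(δ_n)}) → 0. -/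
open scoped ENNReal
open Filter

theorem ennreal_mul_div_cancel_left {b c : ℝ≥0∞} (hb : b ≠ 0) (hbtop : b ≠ ⊤) :
    b * c / b = c := by
  rw [mul_comm, ENNReal.mul_div_cancel_right hb hbtop]

/-- One step of the tight iteration, with the error term `J (z / x) / lam` telescoping. -/
theorem tight_step_le {G : Type*} [CommGroup G] {J H : G → ℝ≥0∞}
    (hJmul : ∀ v w : G, J (v * w) ≤ J v + J w) (hJinv : ∀ v : G, J v⁻¹ = J v)
    {l l' a : ℝ≥0∞} (hl0 : l ≠ 0) (hltop : l ≠ ⊤) (hll' : 2 * l ≤ l') (z u x : G)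
    (hmin : ∀ v : G, l * H (u * x) + l * a * J (u * x) + J u
      ≤ l * H (v * x) + l * a * J (v * x) + J v) :
    H (u * x) + a * J (u * x) + 2 * J (z / (u * x)) / l'
      ≤ H z + a * J z + 2 * J (z / x) / l := by
  have h1 := hmin (z / x)
  rw [div_mul_cancel] at h1
  have h2 : J (z / (u * x)) ≤ J (z / x) + J u := by
    have h := hJmul (z / x) u⁻¹
    rw [hJinv] at h
    convert h using 2
    rw [div_mul_eq_div_div_swap, div_eq_mul_inv (z / x)]
  have h3 : l * (H (u * x) + a * J (u * x)) + J (z / (u * x))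
      ≤ l * (H z + a * J z) + 2 * J (z / x) := by
    calc l * (H (u * x) + a * J (u * x)) + J (z / (u * x))
        ≤ l * (H (u * x) + a * J (u * x)) + (J (z / x) + J u) := by gcongr
      _ = l * H (u * x) + l * a * J (u * x) + J u + J (z / x) := by ring
      _ ≤ l * H z + l * a * J z + J (z / x) + J (z / x) := by gcongr
      _ = l * (H z + a * J z) + 2 * J (z / x) := by ring
  have h4 : 2 * J (z / (u * x)) / l' ≤ J (z / (u * x)) / l := by
    calc 2 * J (z / (u * x)) / l' ≤ 2 * J (z / (u * x)) / (2 * l) := by gcongr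
      _ = J (z / (u * x)) / l :=
        ENNReal.mul_div_mul_left _ _ two_ne_zero ENNReal.ofNat_ne_top
  have h5 := ENNReal.div_le_div_right h3 l
  rw [ENNReal.add_div, ENNReal.add_div, ennreal_mul_div_cancel_left hl0 hltop,
    ennreal_mul_div_cancel_left hl0 hltop] at h5
  exact (add_le_add_right h4 _).trans h5

/-- The objective values along the iteration exceed the noise level by `O(1 / k)`. -/
theorem tight_mul_residual_le {G : Type*} [CommGroup G] {J H : G → ℝ≥0∞}
    {lam a : ℕ → ℝ≥0∞} (hlam0 : 0 < lam 0) (hlamtop : ∀ k, lam k ≠ ⊤)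
    (hlam : ∀ k, 2 * lam k ≤ lam (k + 1)) (ha_anti : ∀ k, a (k + 1) ≤ a k)
    (hJmul : ∀ v w : G, J (v * w) ≤ J v + J w) (hJinv : ∀ v : G, J v⁻¹ = J v)
    (hJ1 : J 1 = 0) (z : G) (u x : ℕ → G) (hx0 : x 0 = 1)
    (hxs : ∀ k, x (k + 1) = u k * x k)
    (hmin : ∀ k, ∀ v : G,
      lam k * H (x (k + 1)) + lam k * a k * J (x (k + 1)) + J (u k)
        ≤ lam k * H (v * x k) + lam k * a k * J (v * x k) + J v) (K : ℕ) :
    ((K + 1 : ℕ) : ℝ≥0∞) * (H (x (K + 1)) + a K * J (x (K + 1)))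
      ≤ ((K + 1 : ℕ) : ℝ≥0∞) * H z + ((∑' k, a k) * J z + 2 * J z / lam 0) := by
  have hlampos : ∀ k, lam k ≠ 0 := by
    intro k
    induction k with
    | zero => exact hlam0.ne'
    | succ k ih =>
      intro h
      have := hlam k
      simp [h, ih] at this
  have hanti : Antitone fun k => H (x (k + 1)) + a k * J (x (k + 1)) := by
    refine antitone_nat_of_succ_le fun k => ?_
    have h1 := hmin (k + 1) 1
    rw [one_mul, hJ1, add_zero, mul_assoc, mul_assoc, ← mul_add, ← mul_add] at h1
    have h2 := (ENNReal.mul_le_mul_iff_right (hlampos (k + 1)) (hlamtop (k + 1))).1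
      (le_self_add.trans h1)
    have := ha_anti k
    exact h2.trans (by gcongr)
  have hsum : ∀ N : ℕ, ∑ k ∈ Finset.range N, (H (x (k + 1)) + a k * J (x (k + 1)))
      + 2 * J (z / x N) / lam N
      ≤ N * H z + ((∑ k ∈ Finset.range N, a k) * J z + 2 * J z / lam 0) := by
    intro N
    induction N with
    | zero => simp [hx0]
    | succ N ih =>
      have hstep := tight_step_le hJmul hJinv (hlampos N) (hlamtop N) (hlam N) z (u N) (x N)
        (by simpa only [hxs] using hmin N)
      rw [← hxs] at hstep
      rw [Finset.sum_range_succ, Finset.sum_range_succ, add_assoc]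
      calc _ ≤ ∑ k ∈ Finset.range N, (H (x (k + 1)) + a k * J (x (k + 1)))
            + (H z + a N * J z + 2 * J (z / x N) / lam N) := by gcongr
        _ = (∑ k ∈ Finset.range N, (H (x (k + 1)) + a k * J (x (k + 1)))
            + 2 * J (z / x N) / lam N) + (H z + a N * J z) := by ring
        _ ≤ (N * H z + ((∑ k ∈ Finset.range N, a k) * J z + 2 * J z / lam 0))
            + (H z + a N * J z) := by gcongr
        _ = _ := by push_cast; ring
  calc _ = ∑ k ∈ Finset.range (K + 1), (H (x (K + 1)) + a K * J (x (K + 1))) := by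
        rw [Finset.sum_const, Finset.card_range, nsmul_eq_mul]
    _ ≤ ∑ k ∈ Finset.range (K + 1), (H (x (k + 1)) + a k * J (x (k + 1))) :=
      Finset.sum_le_sum fun k hk => hanti (Nat.lt_succ_iff.1 (Finset.mem_range.1 hk))
    _ ≤ _ := le_self_add.trans (hsum (K + 1))
    _ ≤ _ := by
      gcongr
      exact ENNReal.sum_le_tsum _

/-- Tight multiplicative MHDM, discrepancy principle: under the penalty conditions
(P), the noise bounds `H(f^{δ_n}, f) ≤ δ_n²` and `∑ a_k < ∞`, for each noise level
the tight stopping set `{k : H(f^{δ_n}, T x_k) + a_k J(x_k) ≥ τ δ_n²}` is bounded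
above (so the stopping index `kstar n`, its maximum, is finite); moreover if
`δ_n → 0` and `kstar n → ∞`, then both `H(f^{δ_n}, T x_{k*(δ_n)}) → 0` and
`a_{k*(δ_n)} J(x_{k*(δ_n)}) → 0`. -/
theorem tight_mhdm_discrepancy {G : Type*} [CommGroup G]
    (J : G → ℝ≥0∞)
    (lam : ℕ → ℝ≥0∞) (hlam0 : 0 < lam 0) (hlamtop : ∀ k, lam k ≠ ⊤)
    (hlam : ∀ k, 2 * lam k ≤ lam (k + 1))
    (a : ℕ → ℝ≥0∞) (hatop : ∀ k, a k ≠ ⊤)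
    (ha_anti : ∀ k, a (k + 1) ≤ a k) (ha0 : Tendsto a atTop (nhds 0))
    (hasum : ∑' k, a k ≠ ⊤)
    (hJmul : ∀ v w : G, J (v * w) ≤ J v + J w)
    (hJinv : ∀ v : G, J v⁻¹ = J v)
    (hJ1 : J 1 = 0)
    (z : G) (hJz : J z ≠ ⊤)
    (τ : ℝ≥0∞) (hτ : 1 < τ) (hτtop : τ ≠ ⊤)
    (δ : ℕ → ℝ≥0∞) (hδpos : ∀ n, 0 < δ n) (hδtop : ∀ n, δ n ≠ ⊤)
    (Hres : ℕ → G → ℝ≥0∞)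
    (u x : ℕ → ℕ → G)
    (hx0 : ∀ n, x n 0 = 1) (hxs : ∀ n k, x n (k + 1) = u n k * x n k)
    (hnoise : ∀ n, Hres n z ≤ δ n ^ 2)
    (hmin : ∀ n k, ∀ v : G,
      lam k * Hres n (x n (k + 1)) + lam k * a k * J (x n (k + 1)) + J (u n k)
        ≤ lam k * Hres n (v * x n k) + lam k * a k * J (v * x n k) + J v)
    (kstar : ℕ → ℕ)
    (hkstar : ∀ n, kstar n
      = sSup {k : ℕ | τ * δ n ^ 2 ≤ Hres n (x n (k + 1)) + a k * J (x n (k + 1))}) :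
    (∀ n, BddAbove {k : ℕ | τ * δ n ^ 2 ≤ Hres n (x n (k + 1)) + a k * J (x n (k + 1))}) ∧
      (Tendsto δ atTop (nhds 0) → Tendsto kstar atTop atTop →
        Tendsto (fun n => Hres n (x n (kstar n + 1))) atTop (nhds 0) ∧
          Tendsto (fun n => a (kstar n) * J (x n (kstar n + 1))) atTop (nhds 0)) := by
  set C := (∑' k, a k) * J z + 2 * J z / lam 0 with hC
  have hCtop : C ≠ ⊤ := ENNReal.add_ne_top.2 ⟨ENNReal.mul_ne_top hasum hJz,
    ENNReal.div_ne_top (ENNReal.mul_ne_top ENNReal.ofNat_ne_top hJz) hlam0.ne'⟩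
  have key : ∀ n K : ℕ,
      ((K + 1 : ℕ) : ℝ≥0∞) * (Hres n (x n (K + 1)) + a K * J (x n (K + 1)))
        ≤ ((K + 1 : ℕ) : ℝ≥0∞) * δ n ^ 2 + C := fun n K =>
    (tight_mul_residual_le hlam0 hlamtop hlam ha_anti hJmul hJinv hJ1 z (u n) (x n) (hx0 n)
      (hxs n) (hmin n) K).trans (by gcongr; exact hnoise n)
  refine ⟨fun n => ?_, fun hδ hk => ?_⟩
  · have hd0 : δ n ^ 2 ≠ 0 := pow_ne_zero _ (hδpos n).ne'
    have hdtop : δ n ^ 2 ≠ ⊤ := ENNReal.pow_ne_top (hδtop n)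
    have hε0 : (τ - 1) * δ n ^ 2 ≠ 0 := mul_ne_zero (tsub_pos_of_lt hτ).ne' hd0
    obtain ⟨M, hM⟩ := ENNReal.exists_nat_mul_gt hε0 hCtop
    refine ⟨M, fun k hk => ?_⟩
    by_contra! hMk
    have h1 : ((k + 1 : ℕ) : ℝ≥0∞) * (τ * δ n ^ 2) ≤ ((k + 1 : ℕ) : ℝ≥0∞) * δ n ^ 2 + C :=
      (mul_le_mul_right hk _).trans (key n k)
    have h2 : ((k + 1 : ℕ) : ℝ≥0∞) * (τ * δ n ^ 2)
        = ((k + 1 : ℕ) : ℝ≥0∞) * δ n ^ 2 + ((k + 1 : ℕ) : ℝ≥0∞) * ((τ - 1) * δ n ^ 2) := by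
      conv_lhs => rw [← add_tsub_cancel_of_le hτ.le]
      ring
    rw [h2] at h1
    have h3 := (ENNReal.add_le_add_iff_left
      (ENNReal.mul_ne_top (ENNReal.natCast_ne_top _) hdtop)).1 h1
    refine (hM.trans_le ?_).not_ge h3
    gcongr
    omega
  · have hbound : ∀ n, Hres n (x n (kstar n + 1)) + a (kstar n) * J (x n (kstar n + 1))
        ≤ δ n ^ 2 + C / ((kstar n + 1 : ℕ) : ℝ≥0∞) := fun n => by
      have hn0 : ((kstar n + 1 : ℕ) : ℝ≥0∞) ≠ 0 := by exact_mod_cast (kstar n).succ_ne_zero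
      have hntop := ENNReal.natCast_ne_top (kstar n + 1)
      have h := ENNReal.div_le_div_right (key n (kstar n)) ((kstar n + 1 : ℕ) : ℝ≥0∞)
      rwa [ENNReal.add_div, ennreal_mul_div_cancel_left hn0 hntop,
        ennreal_mul_div_cancel_left hn0 hntop] at h
    have hlim : Tendsto (fun n => δ n ^ 2 + C / ((kstar n + 1 : ℕ) : ℝ≥0∞)) atTop (nhds 0) := by
      have h1 : Tendsto (fun n => δ n ^ 2) atTop (nhds 0) := by
        simpa using ENNReal.Tendsto.pow (n := 2) hδ
      have h2 : Tendsto (fun n => ((kstar n + 1 : ℕ) : ℝ≥0∞)) atTop (nhds ⊤) :=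
        ENNReal.tendsto_nat_nhds_top.comp ((tendsto_add_atTop_nat 1).comp hk)
      have h3 := ENNReal.Tendsto.const_div h2 (Or.inr hCtop)
      rw [ENNReal.div_top] at h3
      simpa using h1.add h3
    exact ⟨tendsto_of_tendsto_of_tendsto_of_le_of_le tendsto_const_nhds hlim
        (fun _ => zero_le) fun n => le_self_add.trans (hbound n),
      tendsto_of_tendsto_of_tendsto_of_le_of_le tendsto_const_nhds hlim
        (fun _ => zero_le) fun n => le_add_self.trans (hbound n)⟩
end

section
/- Assume the penalty conditions (P), the noise bound H(f^δ, f) ≤ δ², that the tight multiplicative MHDM iterates u_k with partial products x_k are well-defined, and that ∑_{k=0}^∞ a_k < ∞. If the stopping index is chosen so that k*(δ) ≥ c/δ² for some constant c > 0, then there is a constant C > 0 (independent of δ) with H(f^δ, T x_{k*(δ)}) + a_{k*(δ)}·J(x_{k*(δ)}) ≤ C·δ² for all sufficiently small δ > 0. -/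
open scoped ENNReal
open Filter

section Descent

variable {G : Type*} [CommGroup G]

/-- One step of the tight multiplicative MHDM, compared with the clean image `z`: the energy
together with the scaled penalty of `z / x (k + 1)` is controlled by that of `z / x k`. -/
theorem mhdm_step_le {J h : G → ℝ≥0∞} {l α : ℝ≥0∞} (hl0 : l ≠ 0) (hl : l ≠ ⊤)
    (hJmul : ∀ v w : G, J (v * w) ≤ J v + J w) (hJinv : ∀ v : G, J v⁻¹ = J v)
    {u w z : G}
    (hmin : ∀ v : G,
      l * h (u * w) + l * α * J (u * w) + J u ≤ l * h (v * w) + l * α * J (v * w) + J v) :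
    (h (u * w) + α * J (u * w)) + l⁻¹ * J (z * (u * w)⁻¹)
      ≤ (h z + α * J z) + l⁻¹ * (2 * J (z * w⁻¹)) := by
  have hp : J (z * (u * w)⁻¹) ≤ J u + J (z * w⁻¹) := by
    have hfac : z * (u * w)⁻¹ = u⁻¹ * (z * w⁻¹) := by
      rw [mul_inv, mul_left_comm]
    rw [hfac, ← hJinv u]
    exact hJmul _ _
  have hz := hmin (z * w⁻¹)
  rw [inv_mul_cancel_right] at hz
  have hcancel : ∀ t : ℝ≥0∞, l * (l⁻¹ * t) = t := fun t => by
    rw [← mul_assoc, ENNReal.mul_inv_cancel hl0 hl, one_mul]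
  rw [← ENNReal.mul_le_mul_iff_right hl0 hl, mul_add, mul_add l (h z + _), hcancel, hcancel]
  calc l * (h (u * w) + α * J (u * w)) + J (z * (u * w)⁻¹)
      ≤ l * (h (u * w) + α * J (u * w)) + (J u + J (z * w⁻¹)) := by gcongr
    _ = (l * h (u * w) + l * α * J (u * w) + J u) + J (z * w⁻¹) := by ring
    _ ≤ (l * h z + l * α * J z + J (z * w⁻¹)) + J (z * w⁻¹) := by gcongr
    _ = l * (h z + α * J z) + 2 * J (z * w⁻¹) := by ring

/-- The energies of the tight multiplicative MHDM decrease. -/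
theorem mhdm_energy_le {J h : G → ℝ≥0∞} {l α : ℝ≥0∞} (hl0 : l ≠ 0) (hl : l ≠ ⊤)
    (hJ1 : J 1 = 0) {u w : G}
    (hmin : ∀ v : G,
      l * h (u * w) + l * α * J (u * w) + J u ≤ l * h (v * w) + l * α * J (v * w) + J v) :
    h (u * w) + α * J (u * w) ≤ h w + α * J w := by
  have h1 := hmin 1
  rw [one_mul, hJ1, add_zero] at h1
  rw [← ENNReal.mul_le_mul_iff_right hl0 hl, mul_add, mul_add, ← mul_assoc, ← mul_assoc]
  exact le_self_add.trans h1

/-- The energies of the tight multiplicative MHDM decay like `1 / (n + 1)` up to the data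
misfit of the clean image `z`. -/
theorem mhdm_energy_mul_le {J h : G → ℝ≥0∞} {lam a : ℕ → ℝ≥0∞}
    (hlam0 : ∀ k, lam k ≠ 0) (hlamtop : ∀ k, lam k ≠ ⊤) (hlam : ∀ k, 2 * lam k ≤ lam (k + 1))
    (ha : Antitone a)
    (hJmul : ∀ v w : G, J (v * w) ≤ J v + J w) (hJinv : ∀ v : G, J v⁻¹ = J v) (hJ1 : J 1 = 0)
    (z : G) {u x : ℕ → G} (hx0 : x 0 = 1) (hxs : ∀ k, x (k + 1) = u k * x k)
    (hmin : ∀ k, ∀ v : G,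
      lam k * h (x (k + 1)) + lam k * a k * J (x (k + 1)) + J (u k)
        ≤ lam k * h (v * x k) + lam k * a k * J (v * x k) + J v) (n : ℕ) :
    (n + 1 : ℕ) * (h (x (n + 1)) + a n * J (x (n + 1)))
      ≤ (n + 1 : ℕ) * h z + ((∑' k, a k) * J z + (lam 0)⁻¹ * (2 * J z)) := by
  have hstep : ∀ k, (h (x (k + 1)) + a k * J (x (k + 1))) + (lam k)⁻¹ * J (z * (x (k + 1))⁻¹)
      ≤ (h z + a k * J z) + (lam k)⁻¹ * (2 * J (z * (x k)⁻¹)) := fun k => by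
    have hk := hmin k
    rw [hxs] at hk ⊢
    exact mhdm_step_le (hlam0 k) (hlamtop k) hJmul hJinv hk
  have hanti : Antitone fun k => h (x (k + 1)) + a k * J (x (k + 1)) := by
    refine antitone_nat_of_succ_le fun k => ?_
    have hk := hmin (k + 1)
    rw [hxs (k + 1)] at hk ⊢
    refine (mhdm_energy_le (hlam0 _) (hlamtop _) hJ1 hk).trans ?_
    gcongr
    exact ha k.le_succ
  have hinv : ∀ k, (lam (k + 1))⁻¹ * 2 ≤ (lam k)⁻¹ := fun k => by
    calc (lam (k + 1))⁻¹ * 2 ≤ (2 * lam k)⁻¹ * 2 := by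
          gcongr
          exact hlam k
      _ = (lam k)⁻¹ := by
          rw [ENNReal.mul_inv (by simp) (by simp), mul_right_comm,
            ENNReal.inv_mul_cancel (by simp) (by simp), one_mul]
  have hsum : ∀ m : ℕ, ∑ k ∈ Finset.range (m + 1), (h (x (k + 1)) + a k * J (x (k + 1)))
      + (lam m)⁻¹ * J (z * (x (m + 1))⁻¹)
      ≤ (m + 1 : ℕ) * h z + ((∑ k ∈ Finset.range (m + 1), a k) * J z
        + (lam 0)⁻¹ * (2 * J z)) := by
    intro m
    induction m with
    | zero => simpa [hx0, add_assoc] using hstep 0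
    | succ m ih =>
      rw [Finset.sum_range_succ, Finset.sum_range_succ a, add_assoc]
      calc _ ≤ ∑ k ∈ Finset.range (m + 1), (h (x (k + 1)) + a k * J (x (k + 1)))
            + ((h z + a (m + 1) * J z) + (lam (m + 1))⁻¹ * (2 * J (z * (x (m + 1))⁻¹))) :=
            add_le_add le_rfl (hstep (m + 1))
        _ ≤ ∑ k ∈ Finset.range (m + 1), (h (x (k + 1)) + a k * J (x (k + 1)))
            + ((h z + a (m + 1) * J z) + (lam m)⁻¹ * J (z * (x (m + 1))⁻¹)) := by
            rw [← mul_assoc]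
            gcongr
            exact hinv m
        _ = (∑ k ∈ Finset.range (m + 1), (h (x (k + 1)) + a k * J (x (k + 1)))
            + (lam m)⁻¹ * J (z * (x (m + 1))⁻¹)) + (h z + a (m + 1) * J z) := by ring
        _ ≤ _ := add_le_add ih le_rfl
        _ = _ := by
            push_cast
            ring
  calc (n + 1 : ℕ) * (h (x (n + 1)) + a n * J (x (n + 1)))
      = ∑ _k ∈ Finset.range (n + 1), (h (x (n + 1)) + a n * J (x (n + 1))) := by
        rw [Finset.sum_const, Finset.card_range, nsmul_eq_mul]
    _ ≤ ∑ k ∈ Finset.range (n + 1), (h (x (k + 1)) + a k * J (x (k + 1))) :=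
        Finset.sum_le_sum fun k hk => hanti (Nat.lt_succ_iff.mp (Finset.mem_range.mp hk))
    _ ≤ _ := le_self_add.trans (hsum n)
    _ ≤ _ := by
        gcongr
        exact ENNReal.sum_le_tsum _

end Descent

/-- Tight multiplicative MHDM, a priori stopping rule: under the penalty conditions
(P), the noise bounds `H(f^δ, f) ≤ δ²` and `∑ a_k < ∞`, if the stopping index is
chosen so that `k*(δ) ≥ c/δ²` for some constant `c > 0`, then there is a constant
`C > 0` independent of `δ` with
`H(f^δ, T x_{k*(δ)}) + a_{k*(δ)} J(x_{k*(δ)}) ≤ C δ²` for all sufficiently small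
`δ > 0`.  The data for noise level `δ` are `Hres δ v = H(f^δ, T v)`, iterates
`u δ`, partial products `x δ (k+1) = ∏_{j=0}^k u δ j` with `x δ 0 = 1`. -/
theorem tight_mhdm_a_priori_rate {G : Type*} [CommGroup G]
    (J : G → ℝ≥0∞)
    (lam : ℕ → ℝ≥0∞) (hlam0 : 0 < lam 0) (hlamtop : ∀ k, lam k ≠ ⊤)
    (hlam : ∀ k, 2 * lam k ≤ lam (k + 1))
    (a : ℕ → ℝ≥0∞) (hatop : ∀ k, a k ≠ ⊤)
    (ha_anti : ∀ k, a (k + 1) ≤ a k) (ha0 : Tendsto a atTop (nhds 0))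
    (hasum : ∑' k, a k ≠ ⊤)
    (hJmul : ∀ v w : G, J (v * w) ≤ J v + J w)
    (hJinv : ∀ v : G, J v⁻¹ = J v)
    (hJ1 : J 1 = 0)
    (z : G) (hJz : J z ≠ ⊤)
    (Hres : ℝ≥0∞ → G → ℝ≥0∞)
    (u x : ℝ≥0∞ → ℕ → G)
    (hx0 : ∀ δ, x δ 0 = 1) (hxs : ∀ δ k, x δ (k + 1) = u δ k * x δ k)
    (hnoise : ∀ δ : ℝ≥0∞, 0 < δ → Hres δ z ≤ δ ^ 2)
    (hmin : ∀ δ : ℝ≥0∞, 0 < δ → ∀ k, ∀ v : G,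
      lam k * Hres δ (x δ (k + 1)) + lam k * a k * J (x δ (k + 1)) + J (u δ k)
        ≤ lam k * Hres δ (v * x δ k) + lam k * a k * J (v * x δ k) + J v)
    (kstar : ℝ≥0∞ → ℕ)
    (c : ℝ≥0∞) (hc : 0 < c) (hctop : c ≠ ⊤)
    (hkc : ∀ δ : ℝ≥0∞, 0 < δ → c / δ ^ 2 ≤ (kstar δ : ℝ≥0∞)) :
    ∃ C : ℝ≥0∞, 0 < C ∧ C ≠ ⊤ ∧ ∃ δ₀ : ℝ≥0∞, 0 < δ₀ ∧
      ∀ δ : ℝ≥0∞, 0 < δ → δ ≤ δ₀ →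
        Hres δ (x δ (kstar δ + 1)) + a (kstar δ) * J (x δ (kstar δ + 1))
          ≤ C * δ ^ 2 := by
  have hlampos : ∀ k, lam k ≠ 0 := fun k => by
    induction k with
    | zero => exact hlam0.ne'
    | succ k ih => exact ((pos_iff_ne_zero.mpr (mul_ne_zero two_ne_zero ih)).trans_le (hlam k)).ne'
  set B : ℝ≥0∞ := (∑' k, a k) * J z + (lam 0)⁻¹ * (2 * J z) with hB
  have hBtop : B ≠ ⊤ :=
    ENNReal.add_ne_top.mpr ⟨ENNReal.mul_ne_top hasum hJz,
      ENNReal.mul_ne_top (ENNReal.inv_ne_top.mpr hlam0.ne')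
        (ENNReal.mul_ne_top ENNReal.ofNat_ne_top hJz)⟩
  refine ⟨1 + B / c, by positivity,
    ENNReal.add_ne_top.mpr ⟨ENNReal.one_ne_top, ENNReal.div_ne_top hBtop hc.ne'⟩,
    1, one_pos, fun δ hδ hδ1 => ?_⟩
  have hδ2 : δ ^ 2 ≠ ⊤ := ENNReal.pow_ne_top (ne_top_of_le_ne_top ENNReal.one_ne_top hδ1)
  have hcle : c ≤ (kstar δ + 1 : ℕ) * δ ^ 2 := by
    refine ((ENNReal.div_le_iff (pow_ne_zero 2 hδ.ne') hδ2).mp (hkc δ hδ)).trans ?_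
    gcongr
    exact Nat.le_succ _
  have hN0 : ((kstar δ + 1 : ℕ) : ℝ≥0∞) ≠ 0 := Nat.cast_ne_zero.mpr (Nat.succ_ne_zero _)
  rw [← ENNReal.mul_le_mul_iff_right hN0 (ENNReal.natCast_ne_top _)]
  calc _ ≤ (kstar δ + 1 : ℕ) * Hres δ z + B :=
        mhdm_energy_mul_le hlampos hlamtop hlam (antitone_nat_of_succ_le ha_anti) hJmul hJinv hJ1
          z (hx0 δ) (hxs δ) (hmin δ hδ) (kstar δ)
    _ ≤ (kstar δ + 1 : ℕ) * δ ^ 2 + B / c * c := by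
        rw [ENNReal.div_mul_cancel hc.ne' hctop]
        gcongr
        exact hnoise δ hδ
    _ ≤ (kstar δ + 1 : ℕ) * δ ^ 2 + B / c * ((kstar δ + 1 : ℕ) * δ ^ 2) := by gcongr
    _ = _ := by ring
end
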